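/- arXiv:2601.13306 — 2 statements merged into one kernel-verified Lean document; each statement's English description precedes it below -/
import Mathlib

section
/- Let n and p be natural numbers and y, ŷ real numbers. Assume that for every integer k, |y − (2k+1)·2^{−(n+1)}| ≥ 2^{−p}, and that |y − ŷ| < 2^{−p}. Then there is a unique integer a minimizing |y − a·2^{−n}| over all integers, there is a unique integer a' minimizing |ŷ − a'·2^{−n}| over all integers, and a = a'; that is, y and ŷ have the same unique nearest integer multiple of 2^{−n}. -/
/-- A point within half a step of the grid point `a * d` is strictly closer to it than to any other
integer multiple of `d`. -/
theorem abs_sub_int_mul_lt_of_ne {d x : ℝ} {a b : ℤ} (h : |x - a * d| < d / 2) (hab : b ≠ a) :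
    |x - a * d| < |x - b * d| := by
  have hd : 0 < d := by linarith [abs_nonneg (x - a * d)]
  obtain ⟨h₁, h₂⟩ := abs_lt.mp h
  refine h.trans_le (le_abs.mpr ?_)
  rcases lt_or_gt_of_ne hab with hlt | hlt
  · have hle : (b : ℝ) + 1 ≤ a := by exact_mod_cast hlt
    left
    nlinarith [mul_le_mul_of_nonneg_right hle hd.le]
  · have hle : (a : ℝ) + 1 ≤ b := by exact_mod_cast hlt
    right
    nlinarith [mul_le_mul_of_nonneg_right hle hd.le]

theorem abs_sub_int_mul_le {d x : ℝ} {a : ℤ} (h : |x - a * d| < d / 2) (b : ℤ) :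
    |x - a * d| ≤ |x - b * d| := by
  rcases eq_or_ne b a with rfl | hab
  · exact le_rfl
  · exact (abs_sub_int_mul_lt_of_ne h hab).le

theorem existsUnique_nearest_int_mul {d x : ℝ} {a : ℤ} (h : |x - a * d| < d / 2) :
    ∃! a : ℤ, ∀ b : ℤ, |x - a * d| ≤ |x - b * d| := by
  refine ⟨a, abs_sub_int_mul_le h, fun c hc => ?_⟩
  by_contra hne
  exact (abs_sub_int_mul_lt_of_ne h hne).not_ge (hc a)

/-- If `x` is at distance at least `e` from every midpoint of the grid of step `d`, then every point
at distance less than `e` from `x` lies within half a step of one common grid point. -/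
theorem exists_int_forall_abs_sub_lt_half {d e x : ℝ} (hd : 0 < d)
    (hx : ∀ k : ℤ, e ≤ |x - (2 * (k : ℝ) + 1) * (d / 2)|) :
    ∃ a : ℤ, ∀ z : ℝ, |x - z| < e → |z - a * d| < d / 2 := by
  obtain ⟨a, ha⟩ : ∃ a : ℤ, a = ⌊x / d + 1 / 2⌋ := ⟨_, rfl⟩
  obtain ⟨h₁, h₂⟩ := Int.floor_eq_iff.mp ha.symm
  have hxd : x / d * d = x := div_mul_cancel₀ x hd.ne'
  have lo : (a : ℝ) * d ≤ x + d / 2 := by nlinarith [mul_le_mul_of_nonneg_right h₁ hd.le]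
  have hi : x + d / 2 < a * d + d := by nlinarith [mul_lt_mul_of_pos_right h₂ hd]
  refine ⟨a, fun z hz => ?_⟩
  obtain ⟨z₁, z₂⟩ := abs_lt.mp hz
  have above := hx a
  have below := hx (a - 1)
  push_cast at below
  rw [abs_of_nonpos (by linarith)] at above
  rw [abs_of_nonneg (by linarith)] at below
  exact abs_lt.mpr ⟨by linarith, by linarith⟩

/-- Correct-rounding criterion underlying the table maker's dilemma: if `y` is at
distance at least `2^{-p}` from every rounding breakpoint `(2k+1)·2^{-(n+1)}` and
`|y − y'| < 2^{-p}`, then `y` and `y'` each have a unique nearest integer multiple of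
`2^{-n}`, and these nearest multiples coincide. -/
theorem stmt_4 (n p : ℕ) (y y' : ℝ)
    (hy : ∀ k : ℤ, ((2 : ℝ) ^ p)⁻¹ ≤ |y - (2 * (k : ℝ) + 1) * ((2 : ℝ) ^ (n + 1))⁻¹|)
    (hy' : |y - y'| < ((2 : ℝ) ^ p)⁻¹) :
    (∃! a : ℤ, ∀ b : ℤ, |y - (a : ℝ) * ((2 : ℝ) ^ n)⁻¹| ≤ |y - (b : ℝ) * ((2 : ℝ) ^ n)⁻¹|) ∧
    (∃! a : ℤ, ∀ b : ℤ, |y' - (a : ℝ) * ((2 : ℝ) ^ n)⁻¹| ≤ |y' - (b : ℝ) * ((2 : ℝ) ^ n)⁻¹|) ∧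
    (∃ a : ℤ, (∀ b : ℤ, |y - (a : ℝ) * ((2 : ℝ) ^ n)⁻¹| ≤ |y - (b : ℝ) * ((2 : ℝ) ^ n)⁻¹|) ∧
      (∀ b : ℤ, |y' - (a : ℝ) * ((2 : ℝ) ^ n)⁻¹| ≤ |y' - (b : ℝ) * ((2 : ℝ) ^ n)⁻¹|)) := by
  have half : ((2 : ℝ) ^ (n + 1))⁻¹ = ((2 : ℝ) ^ n)⁻¹ / 2 := by
    rw [pow_succ, mul_inv, div_eq_mul_inv]
  rw [half] at hy
  obtain ⟨a, ha⟩ := exists_int_forall_abs_sub_lt_half (by positivity) hy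
  have near := ha y (by simp)
  have near' := ha y' hy'
  exact ⟨existsUnique_nearest_int_mul near, existsUnique_nearest_int_mul near',
    a, abs_sub_int_mul_le near, abs_sub_int_mul_le near'⟩
end

section
/- For every nonzero rational number x, both sin x and cos x (with x viewed as a real number, in radians) are irrational. -/
open Polynomial in
/-- Clearing denominators in the value of an integer polynomial at a rational multiple of `I`. -/
lemma exists_gaussianInt_eq_pow_mul_aeval (g : ℤ[X]) (a b : ℤ) (hb : b ≠ 0) (N : ℕ)
    (hN : g.natDegree ≤ N) :
    ∃ z : GaussianInt, GaussianInt.toComplex z =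
      (b : ℂ) ^ N * aeval ((a : ℂ) / b * Complex.I) g := by
  have hb' : (b : ℂ) ≠ 0 := Int.cast_ne_zero.mpr hb
  refine ⟨(b : GaussianInt) ^ (N - g.natDegree) *
    aeval (⟨0, a⟩ : GaussianInt) (g.scaleRoots b), ?_⟩
  have hz : GaussianInt.toComplex ⟨0, a⟩ = (b : ℂ) * ((a : ℂ) / b * Complex.I) := by
    rw [GaussianInt.toComplex_def']
    field_simp
    simp
  have key := scaleRoots_eval₂_mul (p := g) (algebraMap ℤ ℂ) ((a : ℂ) / b * Complex.I) b
  rw [map_mul, map_pow, map_intCast, aeval_def, hom_eval₂, hz,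
    RingHom.ext_int (GaussianInt.toComplex.comp (algebraMap ℤ GaussianInt)) (algebraMap ℤ ℂ)]
  rw [eq_intCast] at key
  rw [key, ← mul_assoc, ← pow_add, Nat.sub_add_cancel hN, aeval_def]

open Filter Topology in
lemma eventually_mul_pow_div_factorial_pred_lt_one (K C : ℝ) :
    ∀ᶠ p : ℕ in atTop, K * (C ^ p / (p - 1).factorial) < 1 := by
  have h := (FloorSemiring.tendsto_pow_div_factorial_atTop C).const_mul (K * C)
  rw [mul_zero] at h
  have h' := (h.comp (tendsto_sub_atTop_nat 1)).eventually (gt_mem_nhds zero_lt_one)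
  filter_upwards [h', eventually_ge_atTop 1] with p hp h1
  refine lt_of_eq_of_lt ?_ hp
  obtain ⟨q, rfl⟩ := Nat.exists_eq_add_of_le' h1
  simp only [Function.comp_apply, Nat.add_sub_cancel, pow_succ]
  ring

open Polynomial in
/-- The cosine of a nonzero rational number is not a nonzero rational number. -/
lemma cos_ratCast_ne_ratCast {x y : ℚ} (hx : x ≠ 0) (hy : y ≠ 0) :
    Real.cos x ≠ y := by
  intro hxy
  set a : ℤ := x.num
  set b : ℤ := (x.den : ℤ)
  set m : ℤ := y.num
  set k : ℤ := (y.den : ℤ)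
  have ha : a ≠ 0 := Rat.num_ne_zero.mpr hx
  have hb : b ≠ 0 := Int.natCast_ne_zero.mpr x.den_nz
  have hm : m ≠ 0 := Rat.num_ne_zero.mpr hy
  have hk : k ≠ 0 := Int.natCast_ne_zero.mpr y.den_nz
  have hbC : (b : ℂ) ≠ 0 := Int.cast_ne_zero.mpr hb
  have hkR : (k : ℝ) ≠ 0 := Int.cast_ne_zero.mpr hk
  have hxab : (x : ℝ) = a / b := by simp [a, b, Rat.cast_def]
  have hymk : (y : ℝ) = m / k := by simp [m, k, Rat.cast_def]
  set r : ℂ := (a : ℂ) / b * Complex.I with hr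
  have hexp : (Complex.exp r).re = m / k := by
    have : r = ((x : ℝ) : ℂ) * Complex.I := by rw [hr, hxab]; push_cast; rfl
    rw [this, Complex.exp_ofReal_mul_I_re, hxy, hymk]
  set f : ℤ[X] := C (b ^ 2) * X ^ 2 + C (a ^ 2) with hf
  have hf0 : f.eval 0 = a ^ 2 := by simp [hf]
  have hf0' : f.eval 0 ≠ 0 := by rw [hf0]; positivity
  have hfdeg : f.natDegree ≤ 2 := by rw [hf]; compute_degree
  have hroot : r ∈ f.aroots ℂ := by
    rw [mem_aroots]
    refine ⟨fun h ↦ hf0' (by simp [h]), ?_⟩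
    simp only [hf, hr, map_add, map_mul, map_pow, aeval_X, eq_intCast, map_intCast]
    field_simp
    rw [Complex.I_sq]
    ring
  obtain ⟨c, hc⟩ := LindemannWeierstrass.exp_polynomial_approx f hf0'
  obtain ⟨P, hP⟩ := Filter.eventually_atTop.mp
    (eventually_mul_pow_div_factorial_pred_lt_one |(k : ℝ)| (b ^ 2 * c))
  obtain ⟨p, hp, hprime⟩ := Nat.exists_infinite_primes
    (P + (f.eval 0).natAbs + b.natAbs + m.natAbs + 1)
  obtain ⟨n, hpn, g, hg, happrox⟩ := hc p (by omega) hprime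
  have hgdeg : g.natDegree ≤ 2 * p := by
    have := Nat.mul_le_mul_left p hfdeg
    omega
  obtain ⟨z, hz⟩ := exists_gaussianInt_eq_pow_mul_aeval g a b hb (2 * p) hgdeg
  have not_dvd_of_lt {t : ℤ} (ht : t ≠ 0) (hlt : t.natAbs < p) : ¬ (p : ℤ) ∣ t := fun h ↦
    absurd (Nat.le_of_dvd (Int.natAbs_pos.mpr ht) (Int.natCast_dvd.mp h)) (by omega)
  have hpp : Prime (p : ℤ) := Nat.prime_iff_prime_int.mp hprime
  have hne : b ^ (2 * p) * (n * m) - p * (k * z.re) ≠ 0 := by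
    intro h
    have hdvd : (p : ℤ) ∣ b ^ (2 * p) * (n * m) := ⟨k * z.re, by linarith⟩
    rcases hpp.dvd_or_dvd hdvd with h | h
    · exact not_dvd_of_lt hb (by omega) (hpp.dvd_of_dvd_pow h)
    · exact (hpp.dvd_or_dvd h).elim hpn (not_dvd_of_lt hm (by omega))
  have hone : (1 : ℝ) ≤ |((b ^ (2 * p) * (n * m) - p * (k * z.re) : ℤ) : ℝ)| := by
    exact_mod_cast Int.one_le_abs hne
  have heq : ((b ^ (2 * p) * (n * m) - p * (k * z.re) : ℤ) : ℝ) =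
      k * ((b : ℂ) ^ (2 * p) * (n • Complex.exp r - p • aeval r g)).re := by
    have hexpand : (b : ℂ) ^ (2 * p) * (n • Complex.exp r - p • aeval r g) =
        ((b ^ (2 * p) * n : ℝ) : ℂ) * Complex.exp r - ((p : ℝ) : ℂ) * GaussianInt.toComplex z := by
      rw [hz]
      simp only [nsmul_eq_mul, zsmul_eq_mul]
      push_cast
      ring
    rw [hexpand, Complex.sub_re, Complex.re_ofReal_mul, Complex.re_ofReal_mul, hexp,
      ← GaussianInt.intCast_re]
    push_cast
    field_simp
  have hbound : |(k : ℝ) * ((b : ℂ) ^ (2 * p) * (n • Complex.exp r - p • aeval r g)).re| ≤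
      |(k : ℝ)| * ((b ^ 2 * c) ^ p / (p - 1).factorial) := by
    rw [abs_mul]
    refine mul_le_mul_of_nonneg_left ((Complex.abs_re_le_norm _).trans ?_) (abs_nonneg _)
    rw [norm_mul, norm_pow, Complex.norm_intCast, pow_mul, sq_abs, mul_pow, mul_div_assoc]
    exact mul_le_mul_of_nonneg_left (happrox hroot) (by positivity)
  rw [heq] at hone
  exact absurd (hone.trans hbound) (not_le.mpr (hP p (by omega)))

lemma irrational_cos_ratCast {x : ℚ} (hx : x ≠ 0) : Irrational (Real.cos x) := by
  rintro ⟨y, hy⟩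
  rcases eq_or_ne y 0 with rfl | hy0
  · refine cos_ratCast_ne_ratCast (x := 2 * x) (y := -1) (by simpa using hx) (by norm_num) ?_
    push_cast
    rw [Real.cos_two_mul, ← hy]
    norm_num
  · exact cos_ratCast_ne_ratCast hx hy0 hy.symm

/-- Niven–Lehmer: for every nonzero rational `x` (in radians), both `sin x` and `cos x`
are irrational. Hence the only dyadic (floating-point) input at which `sin` or `cos`
takes a rational value is `x = 0`. -/
theorem stmt_11 (x : ℚ) (hx : x ≠ 0) :
    Irrational (Real.sin x) ∧ Irrational (Real.cos x) := by
  refine ⟨?_, irrational_cos_ratCast hx⟩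
  rintro ⟨y, hy⟩
  refine irrational_cos_ratCast (x := 2 * x) (by simpa using hx) ⟨1 - 2 * y ^ 2, ?_⟩
  push_cast
  rw [Real.cos_two_mul, Real.cos_sq', ← hy]
  ring
end
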